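/- Let H be a 2N×2N real symmetric invertible matrix, Σ_pp, Σ_qq, Σ_pq N×N diagonal matrices with Σ_p := [[Σ_pp, Σ_pq],[Σ_pq, Σ_qq]] positive definite, and Σ_nv, Σ_nθ, Σ_nvθ N×N diagonal matrices with Σ_n := [[Σ_nv, Σ_nvθ],[Σ_nvθ, Σ_nθ]] positive definite. For each i set σ_n^i := Σ_nv(i,i) + Σ_nθ(i,i) + √((Σ_nv(i,i) − Σ_nθ(i,i))² + 4·Σ_nvθ(i,i)²) and σ_p^i := Σ_pp(i,i) + Σ_qq(i,i) − √((Σ_pp(i,i) − Σ_qq(i,i))² + 4·Σ_pq(i,i)²). Let Σ_v := H⁻¹ Σ_p H⁻¹ and write Σ_v⁻¹ = [[J_vv, J_vθ],[J_θv, J_θθ]] and (Σ_v + Σ_n)⁻¹ = [[J̃_vv, J̃_vθ],[J̃_θv, J̃_θθ]] in N×N blocks. Suppose there exist i ≠ j with J_vv(i,j) ≠ 0 and i ≠ j with (J_vv + J_θθ)(i,j) < 0, and set γ₁ := min{ |J_vv(i,j)| : i ≠ j, J_vv(i,j) ≠ 0 } and γ₂ := min{ |(J_vv + J_θθ)(i,j)|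 : i ≠ j, (J_vv + J_θθ)(i,j) < 0 }. If max_i σ_n^i < min(2γ₁, γ₂) · (min_i σ_p^i)² / (8·(λmax(H²))²), then for every pair i ≠ j: |J̃_vv(i,j)| > γ₁/2 if and only if J_vv(i,j) ≠ 0, and (J̃_vv + J̃_θθ)(i,j) < −γ₂/2 if and only if (J_vv + J_θθ)(i,j) < 0. -/

import Mathlib

open Matrix

/-- The largest eigenvalue of a real symmetric (Hermitian) matrix. -/
noncomputable def maxEig {n : Type*} [Fintype n] [DecidableEq n]
    {A : Matrix n n ℝ} (hA : A.IsHermitian) : ℝ := ⨆ k, hA.eigenvalues k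

/-- The Rayleigh quotient of a real symmetric matrix is at most its largest eigenvalue. -/
theorem dotProduct_mulVec_le_maxEig {n : Type*} [Fintype n] [DecidableEq n]
    {A : Matrix n n ℝ} (hA : A.IsHermitian) (x : n → ℝ) :
    x ⬝ᵥ A *ᵥ x ≤ maxEig hA * (x ⬝ᵥ x) := by
  set U : Matrix n n ℝ := (hA.eigenvectorUnitary : Matrix n n ℝ)
  have hUU : U * star U = 1 := Unitary.coe_mul_star_self hA.eigenvectorUnitary
  have hsp : A = U * diagonal hA.eigenvalues * star U := by
    have h := hA.spectral_theorem
    rw [Unitary.conjStarAlgAut_apply] at h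
    exact h
  have hpsd : (maxEig hA • (1 : Matrix n n ℝ) - A).PosSemidef := by
    have hd : (diagonal fun k => maxEig hA - hA.eigenvalues k).PosSemidef := by
      refine PosSemidef.diagonal fun k => sub_nonneg.2 ?_
      exact le_ciSup (Set.finite_range hA.eigenvalues).bddAbove k
    have hconj := hd.mul_mul_conjTranspose_same U
    have heq : maxEig hA • (1 : Matrix n n ℝ) - A =
        U * (diagonal fun k => maxEig hA - hA.eigenvalues k) * Uᴴ := by
      have hdiag : (diagonal fun k => maxEig hA - hA.eigenvalues k) =
          maxEig hA • (1 : Matrix n n ℝ) - diagonal hA.eigenvalues := by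
        rw [smul_one_eq_diagonal, diagonal_sub]
      rw [hdiag, mul_sub, sub_mul, ← star_eq_conjTranspose, ← hsp, mul_smul_comm, mul_one,
        smul_mul_assoc, hUU]
    rwa [heq]
  have h := hpsd.dotProduct_mulVec_nonneg x
  simp only [star_trivial, sub_mulVec, smul_mulVec, one_mulVec, dotProduct_sub,
    dotProduct_smul, smul_eq_mul] at h
  linarith

/-- A matrix between `0` and `c • 1` has entries of absolute value at most `c`. -/
theorem Matrix.PosSemidef.abs_apply_le {n : Type*} [Fintype n] [DecidableEq n]
    {D : Matrix n n ℝ} (hD : D.PosSemidef) {c : ℝ}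
    (hc : ∀ x : n → ℝ, x ⬝ᵥ D *ᵥ x ≤ c * (x ⬝ᵥ x)) (i j : n) : |D i j| ≤ c := by
  have hdiag : ∀ k, D k k ≤ c := fun k => by
    have h := hc (Pi.single k 1)
    simpa using h
  have hsymm : D j i = D i j := by simpa using hD.isHermitian.apply i j
  have hadd := hD.dotProduct_mulVec_nonneg (Pi.single i 1 + Pi.single j 1)
  have hsub := hD.dotProduct_mulVec_nonneg (Pi.single i 1 - Pi.single j 1)
  simp only [star_trivial, mulVec_add, mulVec_sub, add_dotProduct, sub_dotProduct,
    dotProduct_add, dotProduct_sub, mulVec_single_one, single_one_dotProduct, col_apply]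
    at hadd hsub
  have hi := hdiag i
  have hj := hdiag j
  rw [abs_le]
  constructor <;> linarith

/-- The inverse of a positive definite matrix decreases under positive definite perturbations. -/
theorem posSemidef_inv_sub_inv_add {n : Type*} [Fintype n] [DecidableEq n]
    {A B : Matrix n n ℝ} (hA : A.PosDef) (hB : B.PosDef) :
    (A⁻¹ - (A + B)⁻¹).PosSemidef := by
  have hC := hA.add hB
  have hA1 : A⁻¹ * A = 1 := nonsing_inv_mul A ((isUnit_iff_isUnit_det A).1 hA.isUnit)
  have hA2 : A * A⁻¹ = 1 := mul_nonsing_inv A ((isUnit_iff_isUnit_det A).1 hA.isUnit)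
  have hC1 : (A + B)⁻¹ * (A + B) = 1 :=
    nonsing_inv_mul _ ((isUnit_iff_isUnit_det _).1 hC.isUnit)
  have hC2 : (A + B) * (A + B)⁻¹ = 1 :=
    mul_nonsing_inv _ ((isUnit_iff_isUnit_det _).1 hC.isUnit)
  have hCH : ((A + B)⁻¹)ᴴ = (A + B)⁻¹ := hC.inv.isHermitian
  set K := (A + B)⁻¹
  have h := (hB.posSemidef.add
    (hA.inv.posSemidef.conjTranspose_mul_mul_same B)).conjTranspose_mul_mul_same K
  have heq : A⁻¹ - K = Kᴴ * (B + Bᴴ * A⁻¹ * B) * K := by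
    rw [hCH, hB.isHermitian]
    have h1 : B + B * A⁻¹ * B = (A + B) * A⁻¹ * (A + B) - (A + B) := by
      simp only [add_mul, mul_add, hA2, one_mul, mul_assoc, hA1, mul_one]
      abel
    calc A⁻¹ - K = (K * (A + B)) * A⁻¹ * ((A + B) * K) - K * ((A + B) * K) := by
          rw [hC1, hC2, one_mul, mul_one, mul_one]
      _ = _ := by rw [h1]; noncomm_ring
  rwa [heq]

/-- First order upper bound for the perturbed inverse:
`A⁻¹ - (A + B)⁻¹ ≤ A⁻¹ * B * A⁻¹`. -/
theorem dotProduct_inv_sub_inv_add_mulVec_le {n : Type*} [Fintype n] [DecidableEq n]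
    {A B : Matrix n n ℝ} (hA : A.PosDef) (hB : B.PosDef) (x : n → ℝ) :
    x ⬝ᵥ (A⁻¹ - (A + B)⁻¹) *ᵥ x ≤ (A⁻¹ *ᵥ x) ⬝ᵥ B *ᵥ (A⁻¹ *ᵥ x) := by
  have hC := hA.add hB
  have hA1 : A⁻¹ * A = 1 := nonsing_inv_mul A ((isUnit_iff_isUnit_det A).1 hA.isUnit)
  have hA2 : A * A⁻¹ = 1 := mul_nonsing_inv A ((isUnit_iff_isUnit_det A).1 hA.isUnit)
  have hC1 : (A + B)⁻¹ * (A + B) = 1 :=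
    nonsing_inv_mul _ ((isUnit_iff_isUnit_det _).1 hC.isUnit)
  have hC2 : (A + B) * (A + B)⁻¹ = 1 :=
    mul_nonsing_inv _ ((isUnit_iff_isUnit_det _).1 hC.isUnit)
  have hAH : (A⁻¹)ᴴ = A⁻¹ := hA.inv.isHermitian
  have heq : A⁻¹ * B * A⁻¹ - (A⁻¹ - (A + B)⁻¹) =
      (B * A⁻¹)ᴴ * (A + B)⁻¹ * (B * A⁻¹) := by
    rw [conjTranspose_mul, hAH, hB.isHermitian]
    set K := (A + B)⁻¹
    have h1 : B * A⁻¹ = (A + B) * A⁻¹ - 1 := by rw [add_mul, hA2]; abel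
    have h2 : A⁻¹ * B = A⁻¹ * (A + B) - 1 := by rw [mul_add, hA1]; abel
    have h3 : A⁻¹ * B * A⁻¹ = A⁻¹ * ((A + B) * A⁻¹) - A⁻¹ := by
      rw [mul_assoc, h1, mul_sub, mul_one]
    rw [h3, h1, h2]
    calc A⁻¹ * ((A + B) * A⁻¹) - A⁻¹ - (A⁻¹ - K)
        = A⁻¹ * ((A + B) * K) * ((A + B) * A⁻¹) - A⁻¹ * ((A + B) * K)
            - (K * (A + B)) * A⁻¹ + K := by
          rw [hC1, hC2, one_mul, mul_one]; abel
      _ = _ := by noncomm_ring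
  have h := (hC.inv.posSemidef.conjTranspose_mul_mul_same (B * A⁻¹)).dotProduct_mulVec_nonneg x
  rw [← heq] at h
  have hx : x ⬝ᵥ (A⁻¹ * B * A⁻¹) *ᵥ x = (A⁻¹ *ᵥ x) ⬝ᵥ B *ᵥ (A⁻¹ *ᵥ x) := by
    rw [mul_assoc, ← mulVec_mulVec, ← mulVec_mulVec, dotProduct_mulVec,
      ← mulVec_transpose, ← conjTranspose_eq_transpose_of_trivial, hAH]
  rw [star_trivial, sub_mulVec (A⁻¹ * B * A⁻¹), dotProduct_sub, hx] at h
  linarith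

/-- The larger eigenvalue of a symmetric `2 × 2` matrix bounds its quadratic form. -/
theorem binary_quadratic_form_le (a b c x y : ℝ) :
    a * x ^ 2 + 2 * c * x * y + b * y ^ 2 ≤
      (a + b + Real.sqrt ((a - b) ^ 2 + 4 * c ^ 2)) / 2 * (x ^ 2 + y ^ 2) := by
  set s := Real.sqrt ((a - b) ^ 2 + 4 * c ^ 2)
  have hsq : s ^ 2 = (a - b) ^ 2 + 4 * c ^ 2 := Real.sq_sqrt (by positivity)
  have habs : |a - b| ≤ s := Real.abs_le_sqrt (by nlinarith [sq_nonneg c])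
  obtain ⟨h1, h2⟩ := abs_le.1 habs
  have hcs : 2 * |c * (2 * x * y)| ≤
      2 * ((s - (a - b)) / 2 * x ^ 2 + (s + (a - b)) / 2 * y ^ 2) := by
    gcongr
    refine abs_le_of_sq_le_sq ?_ ?_
    · have hc : c ^ 2 = (s - (a - b)) / 2 * ((s + (a - b)) / 2) := by linarith
      have : (c * (2 * x * y)) ^ 2 =
          4 * ((s - (a - b)) / 2 * ((s + (a - b)) / 2)) * x ^ 2 * y ^ 2 := by rw [← hc]; ring
      rw [this]
      nlinarith [sq_nonneg ((s - (a - b)) / 2 * x ^ 2 - (s + (a - b)) / 2 * y ^ 2)]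
    · have : 0 ≤ s - (a - b) := by linarith
      have : 0 ≤ s + (a - b) := by linarith
      positivity
  have := le_abs_self (c * (2 * x * y))
  linarith

/-- The smaller eigenvalue of a symmetric `2 × 2` matrix bounds its quadratic form from below. -/
theorem le_binary_quadratic_form (a b c x y : ℝ) :
    (a + b - Real.sqrt ((a - b) ^ 2 + 4 * c ^ 2)) / 2 * (x ^ 2 + y ^ 2) ≤
      a * x ^ 2 + 2 * c * x * y + b * y ^ 2 := by
  have h := binary_quadratic_form_le (-a) (-b) (-c) x y
  have hs : (-a - -b) ^ 2 + 4 * (-c) ^ 2 = (a - b) ^ 2 + 4 * c ^ 2 := by ring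
  rw [hs] at h
  linarith

/-- The quadratic form of a symmetric block matrix with diagonal blocks splits into binary
quadratic forms. -/
theorem dotProduct_fromBlocks_mulVec_of_isDiag {n : Type*} [Fintype n] [DecidableEq n]
    {A B C : Matrix n n ℝ} (hA : A.IsDiag) (hB : B.IsDiag) (hC : C.IsDiag) (z : n ⊕ n → ℝ) :
    z ⬝ᵥ fromBlocks A C C B *ᵥ z =
      ∑ i, (A i i * z (.inl i) ^ 2 + 2 * C i i * z (.inl i) * z (.inr i) +
        B i i * z (.inr i) ^ 2) := by
  rw [← hA.diagonal_diag, ← hB.diagonal_diag, ← hC.diagonal_diag, fromBlocks_mulVec]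
  simp only [dotProduct, Fintype.sum_sum_type, Sum.elim_inl, Sum.elim_inr, Pi.add_apply,
    mulVec_diagonal, ← Finset.sum_add_distrib, diag_apply, diagonal_apply_eq,
    Function.comp_apply]
  exact Finset.sum_congr rfl fun i _ => by ring

/-- The squared length of a vector indexed by `n ⊕ n`, as a sum over `n`. -/
theorem dotProduct_self_sum {n : Type*} [Fintype n] (z : n ⊕ n → ℝ) :
    z ⬝ᵥ z = ∑ i, (z (.inl i) ^ 2 + z (.inr i) ^ 2) := by
  simp only [dotProduct, Fintype.sum_sum_type, ← Finset.sum_add_distrib, sq]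

/-- For a positive definite block matrix with diagonal blocks, the diagonal entries satisfy the
trace bound on the discriminant of a positive semidefinite `2 × 2` matrix. -/
theorem sqrt_le_add_of_posDef_fromBlocks {n : Type*} [Fintype n] [DecidableEq n]
    {A B C : Matrix n n ℝ} (hA : A.IsDiag) (hB : B.IsDiag) (hC : C.IsDiag)
    (h : (fromBlocks A C C B).PosDef) (i : n) :
    Real.sqrt ((A i i - B i i) ^ 2 + 4 * C i i ^ 2) ≤ A i i + B i i := by
  have hApos : 0 < A i i := by simpa using h.diag_pos (i := .inl i)
  have hBpos : 0 < B i i := by simpa using h.diag_pos (i := .inr i)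
  have hdet : C i i ^ 2 ≤ A i i * B i i := by
    have hq := h.posSemidef.dotProduct_mulVec_nonneg
      (Sum.elim (Pi.single i (-C i i)) (Pi.single i (A i i)))
    rw [star_trivial, dotProduct_fromBlocks_mulVec_of_isDiag hA hB hC,
      Finset.sum_eq_single i (fun k _ hk => by simp [hk]) (by simp)] at hq
    simp only [Sum.elim_inl, Sum.elim_inr, Pi.single_eq_same] at hq
    nlinarith
  rw [Real.sqrt_le_left (by positivity)]
  nlinarith

/-- If `p ≤ S` with `0 ≤ p`, then `p ‖y‖ ≤ ‖S y‖`, in squared form. -/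
theorem sq_mul_dotProduct_self_le {n : Type*} [Fintype n] {S : Matrix n n ℝ} {p : ℝ}
    (hp : 0 ≤ p) (hS : ∀ y : n → ℝ, p * (y ⬝ᵥ y) ≤ y ⬝ᵥ S *ᵥ y) (y : n → ℝ) :
    p ^ 2 * (y ⬝ᵥ y) ≤ (S *ᵥ y) ⬝ᵥ (S *ᵥ y) := by
  have h : 0 ≤ (S *ᵥ y - p • y) ⬝ᵥ (S *ᵥ y - p • y) := by
    simpa using dotProduct_star_self_nonneg (S *ᵥ y - p • y)
  simp only [dotProduct_sub, sub_dotProduct, dotProduct_smul, smul_dotProduct, smul_eq_mul,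
    dotProduct_comm (S *ᵥ y) y] at h
  nlinarith [mul_le_mul_of_nonneg_left (hS y) hp]

/-- `‖H y‖² ≤ λmax(H²) ‖y‖²` for symmetric `H`. -/
theorem dotProduct_mulVec_self_le_maxEig_sq {n : Type*} [Fintype n] [DecidableEq n]
    {H : Matrix n n ℝ} (hH : H.IsHermitian) (y : n → ℝ) :
    (H *ᵥ y) ⬝ᵥ (H *ᵥ y) ≤ maxEig (hH.pow 2) * (y ⬝ᵥ y) := by
  refine le_of_eq_of_le ?_ (dotProduct_mulVec_le_maxEig (hH.pow 2) y)
  rw [sq, ← mulVec_mulVec, dotProduct_mulVec y, ← mulVec_transpose,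
    ← conjTranspose_eq_transpose_of_trivial, hH]

/-- part 3 of Theorem 6 of the paper: if the noise level `max_i σ_n^i` is
below `min(2γ₁, γ₂) (min_i σ_p^i)² / (8 (λmax(H²))²)`, then both the support rule of
Algorithm 1 (threshold `γ₁/2`) and the sign rule of Algorithm 2 (threshold `γ₂/2`) applied
to the noisy inverse voltage covariance recover the noiseless answers. -/
theorem stmt16 (N : ℕ)
    (H : Matrix (Fin N ⊕ Fin N) (Fin N ⊕ Fin N) ℝ)
    (hH : H.IsHermitian) (hHu : IsUnit H)
    (Spp Sqq Spq Snv Snθ Snvθ : Matrix (Fin N) (Fin N) ℝ)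
    (hSpp : Spp.IsDiag) (hSqq : Sqq.IsDiag) (hSpq : Spq.IsDiag)
    (hSnv : Snv.IsDiag) (hSnθ : Snθ.IsDiag) (hSnvθ : Snvθ.IsDiag)
    (Sp Sn : Matrix (Fin N ⊕ Fin N) (Fin N ⊕ Fin N) ℝ)
    (hSp : Sp = Matrix.fromBlocks Spp Spq Spq Sqq) (hSpd : Sp.PosDef)
    (hSn : Sn = Matrix.fromBlocks Snv Snvθ Snvθ Snθ) (hSnd : Sn.PosDef)
    (σn σp : Fin N → ℝ)
    (hσn : ∀ i, σn i = Snv i i + Snθ i i +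
      Real.sqrt ((Snv i i - Snθ i i) ^ 2 + 4 * (Snvθ i i) ^ 2))
    (hσp : ∀ i, σp i = Spp i i + Sqq i i -
      Real.sqrt ((Spp i i - Sqq i i) ^ 2 + 4 * (Spq i i) ^ 2))
    (Sv : Matrix (Fin N ⊕ Fin N) (Fin N ⊕ Fin N) ℝ) (hSv : Sv = H⁻¹ * Sp * H⁻¹)
    (Jvv Jvθ Jθv Jθθ : Matrix (Fin N) (Fin N) ℝ)
    (hJ : Sv⁻¹ = Matrix.fromBlocks Jvv Jvθ Jθv Jθθ)
    (Jvvt Jvθt Jθvt Jθθt : Matrix (Fin N) (Fin N) ℝ)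
    (hJt : (Sv + Sn)⁻¹ = Matrix.fromBlocks Jvvt Jvθt Jθvt Jθθt)
    (hex1 : ∃ i j, i ≠ j ∧ Jvv i j ≠ 0)
    (hex2 : ∃ i j, i ≠ j ∧ (Jvv + Jθθ) i j < 0)
    (γ₁ γ₂ : ℝ)
    (hγ₁ : γ₁ = sInf {x : ℝ | ∃ i j, i ≠ j ∧ Jvv i j ≠ 0 ∧ x = |Jvv i j|})
    (hγ₂ : γ₂ = sInf {x : ℝ | ∃ i j, i ≠ j ∧ (Jvv + Jθθ) i j < 0 ∧ x = |(Jvv + Jθθ) i j|})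
    (hbound : (⨆ i, σn i) <
      min (2 * γ₁) γ₂ * (⨅ i, σp i) ^ 2 / (8 * (maxEig (hH.pow 2)) ^ 2)) :
    ∀ i j, i ≠ j →
      ((γ₁ / 2 < |Jvvt i j| ↔ Jvv i j ≠ 0) ∧
        ((Jvvt + Jθθt) i j < -(γ₂ / 2) ↔ (Jvv + Jθθ) i j < 0)) := by
  have hσp0 : ∀ i, 0 ≤ σp i := fun i => by
    rw [hσp, sub_nonneg]
    exact sqrt_le_add_of_posDef_fromBlocks hSpp hSqq hSpq (hSp ▸ hSpd) i
  have hσn0 : ∀ i, 0 ≤ σn i := fun i => by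
    have h := sqrt_le_add_of_posDef_fromBlocks hSnv hSnθ hSnvθ (hSn ▸ hSnd) i
    have h0 := Real.sqrt_nonneg ((Snv i i - Snθ i i) ^ 2 + 4 * Snvθ i i ^ 2)
    rw [hσn]
    linarith
  set b := ⨆ i, σn i
  set p := ⨅ i, σp i
  set L := maxEig (hH.pow 2)
  have hb0 : 0 ≤ b := Real.iSup_nonneg hσn0
  have hp0 : 0 ≤ p := Real.iInf_nonneg hσp0
  have hp : 0 < p := by
    refine hp0.lt_of_ne fun h => ?_
    rw [← h] at hbound
    simp at hbound
    linarith
  have hLne : L ≠ 0 := by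
    intro h
    rw [h] at hbound
    simp at hbound
    linarith
  have hSn_le : ∀ y, y ⬝ᵥ Sn *ᵥ y ≤ b / 2 * (y ⬝ᵥ y) := fun y => by
    rw [hSn, dotProduct_fromBlocks_mulVec_of_isDiag hSnv hSnθ hSnvθ, dotProduct_self_sum,
      Finset.mul_sum]
    refine Finset.sum_le_sum fun i _ => (binary_quadratic_form_le _ _ _ _ _).trans ?_
    rw [← hσn]
    gcongr
    exact le_ciSup (Set.finite_range σn).bddAbove i
  have hSp_le : ∀ y, p / 2 * (y ⬝ᵥ y) ≤ y ⬝ᵥ Sp *ᵥ y := fun y => by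
    rw [hSp, dotProduct_fromBlocks_mulVec_of_isDiag hSpp hSqq hSpq, dotProduct_self_sum,
      Finset.mul_sum]
    refine Finset.sum_le_sum fun i _ => le_trans ?_ (le_binary_quadratic_form _ _ _ _ _)
    rw [← hσp]
    gcongr
    exact ciInf_le (Set.finite_range σp).bddBelow i
  have hHinv : (H⁻¹)ᴴ = H⁻¹ := hH.inv
  have hSvd : Sv.PosDef := by
    have h := hSpd.conjTranspose_mul_mul_same (B := H⁻¹)
      (mulVec_injective_of_isUnit ((isUnit_nonsing_inv_iff).2 hHu))
    rwa [hHinv, ← hSv] at h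
  have hHdet : IsUnit H.det := (isUnit_iff_isUnit_det H).1 hHu
  have hSpdet : IsUnit Sp.det := (isUnit_iff_isUnit_det Sp).1 hSpd.isUnit
  have hSvinv : Sv⁻¹ = H * Sp⁻¹ * H := by
    rw [hSv, Matrix.mul_inv_rev, Matrix.mul_inv_rev, nonsing_inv_nonsing_inv H hHdet, mul_assoc]
  set D := Sv⁻¹ - (Sv + Sn)⁻¹ with hD
  have hDpsd : D.PosSemidef := posSemidef_inv_sub_inv_add hSvd hSnd
  obtain ⟨i₀, -⟩ := hex1
  have hL : 0 ≤ L := by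
    have h := dotProduct_mulVec_self_le_maxEig_sq hH (Pi.single (.inl i₀) 1)
    have h0 := dotProduct_star_self_nonneg (H *ᵥ Pi.single (.inl i₀) 1)
    rw [star_trivial] at h0
    simpa using h0.trans h
  have hLpos : 0 < L := hL.lt_of_ne' hLne
  have hDle : ∀ x, x ⬝ᵥ D *ᵥ x ≤ 2 * b * L ^ 2 / p ^ 2 * (x ⬝ᵥ x) := fun x => by
    set u := Sp⁻¹ *ᵥ (H *ᵥ x) with hu
    have h1 := (dotProduct_inv_sub_inv_add_mulVec_le hSvd hSnd x).trans (hSn_le _)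
    have hw : Sv⁻¹ *ᵥ x = H *ᵥ u := by rw [hSvinv, ← mulVec_mulVec, ← mulVec_mulVec]
    have hSu : Sp *ᵥ u = H *ᵥ x := by
      rw [hu, mulVec_mulVec, mul_nonsing_inv _ hSpdet, one_mulVec]
    rw [hw] at h1
    have h2 := dotProduct_mulVec_self_le_maxEig_sq hH u
    have h3 := sq_mul_dotProduct_self_le (by positivity) hSp_le u
    rw [hSu] at h3
    have h4 := h3.trans (dotProduct_mulVec_self_le_maxEig_sq hH x)
    have h5 : u ⬝ᵥ u ≤ 4 * L / p ^ 2 * (x ⬝ᵥ x) := by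
      rw [div_mul_eq_mul_div, le_div_iff₀ (by positivity)]
      linarith
    calc x ⬝ᵥ D *ᵥ x ≤ b / 2 * (L * (u ⬝ᵥ u)) := h1.trans (by gcongr)
      _ ≤ b / 2 * (L * (4 * L / p ^ 2 * (x ⬝ᵥ x))) := by gcongr
      _ = _ := by ring
  have hentry : ∀ k l, |D k l| < min (2 * γ₁) γ₂ / 4 := fun k l => by
    refine (hDpsd.abs_apply_le hDle k l).trans_lt ?_
    rw [lt_div_iff₀ (by positivity)] at hbound
    rw [div_lt_iff₀ (by positivity)]
    linarith
  have hDblocks : D = fromBlocks (Jvv - Jvvt) (Jvθ - Jvθt) (Jθv - Jθvt) (Jθθ - Jθθt) := by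
    rw [hD, hJ, hJt, sub_eq_add_neg, fromBlocks_neg, fromBlocks_add]
    simp only [sub_eq_add_neg]
  intro i j hij
  have hv := hentry (.inl i) (.inl j)
  have hθ := hentry (.inr i) (.inr j)
  rw [hDblocks] at hv hθ
  simp only [fromBlocks_apply₁₁, fromBlocks_apply₂₂, Matrix.sub_apply] at hv hθ
  have hm1 := min_le_left (2 * γ₁) γ₂
  have hm2 := min_le_right (2 * γ₁) γ₂
  constructor
  · constructor
    · intro h h0
      rw [h0, zero_sub, abs_neg] at hv
      linarith
    · intro h
      have hγ : γ₁ ≤ |Jvv i j| := by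
        rw [hγ₁]
        refine csInf_le ⟨0, ?_⟩ ⟨i, j, hij, h, rfl⟩
        rintro _ ⟨k, l, -, -, rfl⟩
        exact abs_nonneg _
      have := abs_sub_abs_le_abs_sub (Jvv i j) (Jvvt i j)
      linarith
  · rw [Matrix.add_apply, Matrix.add_apply]
    rw [abs_lt] at hv hθ
    constructor
    · intro h
      linarith
    · intro h
      have hγ : γ₂ ≤ |(Jvv + Jθθ) i j| := by
        rw [hγ₂]
        refine csInf_le ⟨0, ?_⟩ ⟨i, j, hij, h, rfl⟩
        rintro _ ⟨k, l, -, -, rfl⟩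
        exact abs_nonneg _
      rw [Matrix.add_apply, abs_of_neg h] at hγ
      linarith
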